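/- Let f : ℝ × ℝ^N → ℝ^N be Lipschitz Carathéodory and satisfy: (H1) there are locally integrable α, β : ℝ → ℝ with β(t) ≥ 0 such that 2⟨f(t,x), x⟩ ≤ α(t)|x|² + β(t) for Lebesgue-a.e. (t,x) ∈ ℝ^{1+N}; (H2*) there are constants α₁ > 0 and K ≥ 1 such that exp(∫_s^t α(u) du) ≤ K e^{−α₁(t−s)} for all 0 ≤ s ≤ t; (H3) c₁ := sup_{t ∈ ℝ} ∫_t^{t+1} β(u) du < ∞. Then for each fixed τ ∈ ℝ the solutions of ẋ = f(t,x) are uniformly ultimately bounded on [τ, ∞): there exists c(τ) > 0 such that for every d > 0 there is T(τ, d) > 0 with |x(t + r, f, r, x₀)| ≤ c(τ) whenever r ≥ τ, t ≥ T(τ, d), and |x₀| ≤ d; moreover c(·) and T(·, d) can be taken nonincreasing in τ. -/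

import Mathlib

open MeasureTheory Set Filter Topology
open scoped RealInnerProductSpace

noncomputable section

abbrev Euc (n : ℕ) := EuclideanSpace ℝ (Fin n)

/-- A function `ℝ → ℝ` is locally integrable (w.r.t. Lebesgue measure) on every
compact interval. -/
def LocInt (m : ℝ → ℝ) : Prop := ∀ a b : ℝ, IntegrableOn m (Icc a b)

section Defs

variable {N : ℕ} {F : Type*} [NormedAddCommGroup F] [NormedSpace ℝ F]

/-- The Carathéodory conditions (C1) and (C2). -/
def IsCara (f : ℝ → Euc N → F) : Prop :=
  StronglyMeasurable (Function.uncurry f) ∧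
  ∀ K : Set (Euc N), IsCompact K → ∃ m : ℝ → ℝ, (∀ t, 0 ≤ m t) ∧ LocInt m ∧
    ∀ᵐ t : ℝ, ∀ x ∈ K, ‖f t x‖ ≤ m t

/-- A suitable set of moduli of continuity `Θ = {θ_j^{[q₁,q₂]}}`. -/
structure SuitableModuli where
  θ : ℕ → ℚ → ℚ → ℝ → ℝ
  nonneg : ∀ j q₁ q₂ s, (0:ℝ) ≤ s → 0 ≤ θ j q₁ q₂ s
  cont : ∀ j q₁ q₂, ContinuousOn (θ j q₁ q₂) (Ici 0)
  mono : ∀ j q₁ q₂, MonotoneOn (θ j q₁ q₂) (Ici 0)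
  zero : ∀ j q₁ q₂, θ j q₁ q₂ 0 = 0
  ordered : ∀ j₁ j₂ q₁ q₂ p₁ p₂, j₁ ≤ j₂ → p₁ ≤ q₁ → q₂ ≤ p₂ →
    ∀ s : ℝ, 0 ≤ s → θ j₁ q₁ q₂ s ≤ θ j₂ p₁ p₂ s

/-- `x ∈ K_j^{[q₁,q₂]}`: continuous, bounded by `j` and with modulus of continuity
`θ_j^{[q₁,q₂]}` on `[q₁,q₂]`. -/
def inK {N : ℕ} (Θ : SuitableModuli) (j : ℕ) (q₁ q₂ : ℚ) (x : ℝ → Euc N) : Prop :=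
  ContinuousOn x (Icc (q₁:ℝ) (q₂:ℝ)) ∧
  (∀ t ∈ Icc (q₁:ℝ) (q₂:ℝ), ‖x t‖ ≤ (j:ℝ)) ∧
  ∀ t ∈ Icc (q₁:ℝ) (q₂:ℝ), ∀ s ∈ Icc (q₁:ℝ) (q₂:ℝ), ‖x t - x s‖ ≤ Θ.θ j q₁ q₂ |t - s|

/-- Weak Θ-Carathéodory functions: Carathéodory conditions plus condition (W). -/
def IsWTC (Θ : SuitableModuli) (f : ℝ → Euc N → F) : Prop :=
  IsCara f ∧
  ∀ (j : ℕ) (q₁ q₂ : ℚ) (xs : ℕ → ℝ → Euc N) (x : ℝ → Euc N),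
    (∀ n, inK Θ j q₁ q₂ (xs n)) → inK Θ j q₁ q₂ x →
    TendstoUniformlyOn (fun n t => xs n t) x atTop (Icc (q₁:ℝ) (q₂:ℝ)) →
    Tendsto (fun n => ∫ t in Icc (q₁:ℝ) (q₂:ℝ), f t (xs n t)) atTop
      (𝓝 (∫ t in Icc (q₁:ℝ) (q₂:ℝ), f t (x t)))

/-- Convergence in the `σ_Θ` sense:
`sup_{x ∈ K_j^I} ‖∫_I (f_n(t,x(t)) − f(t,x(t))) dt‖ → 0` for every `j` and `I`. -/
def SigmaTendsto (Θ : SuitableModuli) (fs : ℕ → ℝ → Euc N → F) (f : ℝ → Euc N → F) : Prop :=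
  ∀ (j : ℕ) (q₁ q₂ : ℚ), ∀ ε > (0:ℝ), ∀ᶠ n in atTop, ∀ x : ℝ → Euc N, inK Θ j q₁ q₂ x →
    ‖∫ t in Icc (q₁:ℝ) (q₂:ℝ), (fs n t (x t) - f t (x t))‖ < ε

end Defs

/-- Lipschitz Carathéodory functions. -/
def IsLC {N : ℕ} (f : ℝ → Euc N → Euc N) : Prop :=
  IsCara f ∧
  ∀ K : Set (Euc N), IsCompact K → ∃ l : ℝ → ℝ, LocInt l ∧
    ∀ᵐ t : ℝ, ∀ x ∈ K, ∀ y ∈ K, ‖f t x - f t y‖ ≤ l t * ‖x - y‖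

/-- The optimal m-bound of `f` on the closed ball `B_j`. -/
def mOpt {N : ℕ} (f : ℝ → Euc N → Euc N) (j : ℕ) (t : ℝ) : ℝ :=
  sSup {v : ℝ | ∃ x : Euc N, ‖x‖ ≤ (j:ℝ) ∧ v = ‖f t x‖}

/-- The time translation `f_r(s,x) = f(s+r,x)`. -/
def timeTranslate {N : ℕ} (f : ℝ → Euc N → Euc N) (r : ℝ) : ℝ → Euc N → Euc N :=
  fun s x => f (s + r) x

/-- `x` is a solution of `ẋ = g(t,x)`, `x(0) = x₀`, defined on `[0,∞)`. -/
def IsSolOn {N : ℕ} (g : ℝ → Euc N → Euc N) (x₀ : Euc N) (x : ℝ → Euc N) : Prop :=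
  ContinuousOn x (Ici 0) ∧ ∀ t ∈ Ici (0:ℝ), x t = x₀ + ∫ s in (0:ℝ)..t, g s (x s)

namespace AbsolutelyContinuousOnInterval

theorem lipschitzOnWith_comp {X Y : Type*} [PseudoMetricSpace X] [PseudoMetricSpace Y]
    {f : ℝ → X} {g : X → Y} {a b : ℝ} {C : NNReal} {s : Set X} (hg : LipschitzOnWith C g s)
    (hf : AbsolutelyContinuousOnInterval f a b) (hfs : MapsTo f (uIcc a b) s) :
    AbsolutelyContinuousOnInterval (fun t ↦ g (f t)) a b := by
  rw [absolutelyContinuousOnInterval_iff] at hf ⊢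
  intro ε hε
  obtain ⟨δ, hδ, h⟩ := hf (ε / (C + 1)) (by positivity)
  refine ⟨δ, hδ, fun E hE hEδ ↦ ?_⟩
  have hsum := h E hE hEδ
  have hle : ∑ i ∈ Finset.range E.1, dist (g (f (E.2 i).1)) (g (f (E.2 i).2)) ≤
      ∑ i ∈ Finset.range E.1, C * dist (f (E.2 i).1) (f (E.2 i).2) :=
    Finset.sum_le_sum fun i hi ↦
      hg.dist_le_mul _ (hfs (hE.1 i hi).1) _ (hfs (hE.1 i hi).2)
  rw [← Finset.mul_sum] at hle
  have hnn : 0 ≤ ∑ i ∈ Finset.range E.1, dist (f (E.2 i).1) (f (E.2 i).2) :=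
    Finset.sum_nonneg fun _ _ ↦ dist_nonneg
  rw [lt_div_iff₀ (by positivity)] at hsum
  linarith

theorem exp {f : ℝ → ℝ} {a b : ℝ} (hf : AbsolutelyContinuousOnInterval f a b) :
    AbsolutelyContinuousOnInterval (fun t ↦ Real.exp (f t)) a b := by
  obtain ⟨C, hC⟩ := hf.exists_bound
  have hexp : ContDiffOn ℝ 1 Real.exp (Icc (-C) C) := Real.contDiff_exp.contDiffOn
  obtain ⟨L, hL⟩ := hexp.exists_lipschitzOnWith one_ne_zero (convex_Icc _ _) isCompact_Icc
  have hmaps : MapsTo f (uIcc a b) (Icc (-C) C) := fun t ht ↦ abs_le.1 (hC t ht)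
  have hcomp := lipschitzOnWith_comp hL hf hmaps
  exact hcomp

theorem const {X : Type*} [PseudoMetricSpace X] (c : X) (a b : ℝ) :
    AbsolutelyContinuousOnInterval (fun _ ↦ c) a b :=
  ((LipschitzWith.const c).lipschitzOnWith (s := uIcc a b)).absolutelyContinuousOnInterval

theorem fun_sum {F ι : Type*} [SeminormedAddCommGroup F] (s : Finset ι) {f : ι → ℝ → F} {a b : ℝ}
    (hf : ∀ i ∈ s, AbsolutelyContinuousOnInterval (f i) a b) :
    AbsolutelyContinuousOnInterval (fun t ↦ ∑ i ∈ s, f i t) a b := by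
  classical
  induction s using Finset.induction_on with
  | empty => simpa using const (0 : F) a b
  | insert i s hi ih =>
    simp only [Finset.sum_insert hi]
    exact (hf i (Finset.mem_insert_self i s)).add
      (ih fun j hj ↦ hf j (Finset.mem_insert_of_mem hj))

/-- Grönwall's inequality for absolutely continuous functions. -/
theorem le_exp_integral_mul_add {V α β : ℝ → ℝ} {a b : ℝ} (hab : a ≤ b)
    (hV : AbsolutelyContinuousOnInterval V a b)
    (hα : IntervalIntegrable α volume a b) (hβ : IntervalIntegrable β volume a b)
    (h : ∀ᵐ t, t ∈ uIcc a b → deriv V t ≤ α t * V t + β t) :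
    V b ≤ Real.exp (∫ u in a..b, α u) * V a + ∫ s in a..b, Real.exp (∫ u in s..b, α u) * β s := by
  have hE : AbsolutelyContinuousOnInterval (fun s ↦ Real.exp (∫ u in s..b, α u)) a b := by
    simp_rw [intervalIntegral.integral_symm b]
    exact (hα.absolutelyContinuousOnInterval_intervalIntegral right_mem_uIcc).neg.exp
  have hEV := hE.fun_mul hV
  have hint := hEV.integral_deriv_eq_sub
  have hle : ∫ s in a..b, deriv (fun s ↦ Real.exp (∫ u in s..b, α u) * V s) s ≤
      ∫ s in a..b, Real.exp (∫ u in s..b, α u) * β s := by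
    refine intervalIntegral.integral_mono_ae_restrict hab hEV.intervalIntegrable_deriv
      (hβ.continuousOn_mul hE.continuousOn) ?_
    refine (ae_restrict_iff' measurableSet_Icc).2 ?_
    filter_upwards [h, hV.ae_differentiableAt, hα.ae_hasDerivAt_integral] with t h₁ h₂ h₃ ht
    rw [← uIcc_of_le hab] at ht
    have hdE : HasDerivAt (fun s ↦ Real.exp (∫ u in s..b, α u))
        (Real.exp (∫ u in t..b, α u) * (-α t)) t := by
      simp_rw [intervalIntegral.integral_symm b]
      exact (h₃ ht b right_mem_uIcc).neg.exp
    rw [(hdE.fun_mul (h₂ ht).hasDerivAt).deriv]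
    have := mul_le_mul_of_nonneg_left (h₁ ht) (Real.exp_pos (∫ u in t..b, α u)).le
    linarith
  rw [hint] at hle
  simp only [intervalIntegral.integral_same, Real.exp_zero, one_mul] at hle
  linarith

end AbsolutelyContinuousOnInterval

theorem LocInt.intervalIntegrable {m : ℝ → ℝ} (hm : LocInt m) (a b : ℝ) :
    IntervalIntegrable m volume a b :=
  intervalIntegrable_iff.2 ((hm (min a b) (max a b)).mono_set Ioc_subset_Icc_self)

theorem IsCara.intervalIntegrable_comp {N : ℕ} {f : ℝ → Euc N → Euc N} (hf : IsCara f)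
    {x : ℝ → Euc N} {a b : ℝ} (hab : a ≤ b) (hx : ContinuousOn x (Icc a b)) :
    IntervalIntegrable (fun v ↦ f v (x v)) volume a b := by
  rw [intervalIntegrable_iff_integrableOn_Icc_of_le hab]
  obtain ⟨m, -, hm, hfm⟩ := hf.2 (x '' Icc a b) (isCompact_Icc.image_of_continuousOn hx)
  refine (hm a b).mono' ?_ ?_
  · have hmeas : AEMeasurable (fun v ↦ (v, x v)) (volume.restrict (Icc a b)) :=
      aemeasurable_id.prodMk (hx.aemeasurable measurableSet_Icc)
    exact (hf.1.measurable.comp_aemeasurable hmeas).aestronglyMeasurable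
  · refine (ae_restrict_iff' measurableSet_Icc).2 ?_
    filter_upwards [hfm] with v hv hvI using hv _ (mem_image_of_mem x hvI)

theorem IsLC.ae_continuous {N : ℕ} {f : ℝ → Euc N → Euc N} (hf : IsLC f) :
    ∀ᵐ t : ℝ, Continuous (f t) := by
  have h : ∀ n : ℕ, ∃ l : ℝ → ℝ, LocInt l ∧ ∀ᵐ t : ℝ,
      ∀ x ∈ Metric.closedBall (0 : Euc N) n, ∀ y ∈ Metric.closedBall (0 : Euc N) n,
        ‖f t x - f t y‖ ≤ l t * ‖x - y‖ :=
    fun n ↦ hf.2 _ (isCompact_closedBall _ _)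
  choose l _ hl using h
  filter_upwards [ae_all_iff.2 hl] with t ht
  refine continuous_iff_continuousAt.2 fun x ↦ ?_
  obtain ⟨n, hn⟩ := exists_nat_gt ‖x‖
  have hlip : LipschitzOnWith (l n t).toNNReal (f t) (Metric.closedBall (0 : Euc N) n) :=
    LipschitzOnWith.of_dist_le_mul fun y hy z hz ↦ by
      rw [dist_eq_norm, dist_eq_norm]
      exact (ht n y hy z hz).trans
        (mul_le_mul_of_nonneg_right (Real.le_coe_toNNReal _) (norm_nonneg _))
  exact hlip.continuousOn.continuousAt
    (Metric.closedBall_mem_nhds_of_mem (by simpa using hn))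

theorem IsLC.ae_forall_inner_le {N : ℕ} {f : ℝ → Euc N → Euc N} (hf : IsLC f) {α β : ℝ → ℝ}
    (h : ∀ᵐ p : ℝ × Euc N, 2 * ⟪f p.1 p.2, p.2⟫ ≤ α p.1 * ‖p.2‖ ^ 2 + β p.1) :
    ∀ᵐ t : ℝ, ∀ x : Euc N, 2 * ⟪f t x, x⟫ ≤ α t * ‖x‖ ^ 2 + β t := by
  filter_upwards [Measure.ae_ae_of_ae_prod h, hf.ae_continuous] with t ht hc x
  have hclosed : IsClosed {x : Euc N | 2 * ⟪f t x, x⟫ ≤ α t * ‖x‖ ^ 2 + β t} :=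
    isClosed_le (by fun_prop) (by fun_prop)
  have huniv := (Measure.dense_of_ae ht).closure_eq
  rw [hclosed.closure_eq] at huniv
  exact huniv.ge (mem_univ x)

/-- The Grönwall estimate for the squared norm of a Carathéodory solution. -/
theorem IsLC.norm_sq_le {N : ℕ} {f : ℝ → Euc N → Euc N} (hf : IsLC f) {α β : ℝ → ℝ}
    (hα : LocInt α) (hβ : LocInt β)
    (h : ∀ᵐ p : ℝ × Euc N, 2 * ⟪f p.1 p.2, p.2⟫ ≤ α p.1 * ‖p.2‖ ^ 2 + β p.1)
    {a b : ℝ} (hab : a ≤ b) {x₀ : Euc N} {x : ℝ → Euc N} (hx : ContinuousOn x (Icc a b))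
    (hsol : ∀ u ∈ Icc a b, x u = x₀ + ∫ v in a..u, f v (x v)) :
    ‖x b‖ ^ 2 ≤ Real.exp (∫ u in a..b, α u) * ‖x₀‖ ^ 2 +
      ∫ s in a..b, Real.exp (∫ u in s..b, α u) * β s := by
  have hint := hf.1.intervalIntegrable_comp hab hx
  have hcoord : ∀ i, IntervalIntegrable (fun v ↦ f v (x v) i) volume a b := fun i ↦
    ⟨(EuclideanSpace.proj (𝕜 := ℝ) i).integrable_comp hint.1,
      (EuclideanSpace.proj (𝕜 := ℝ) i).integrable_comp hint.2⟩
  let y : Fin N → ℝ → ℝ := fun i u ↦ x₀ i + ∫ v in a..u, f v (x v) i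
  have hxy : ∀ u ∈ Icc a b, ∀ i, y i u = x u i := by
    intro u hu i
    have hsub : IntervalIntegrable (fun v ↦ f v (x v)) volume a u :=
      hint.mono_set (uIcc_subset_uIcc_left (by rwa [uIcc_of_le hab]))
    have := (EuclideanSpace.proj (𝕜 := ℝ) i).intervalIntegral_comp_comm hsub
    rw [hsol u hu, PiLp.add_apply]
    exact congrArg (x₀ i + ·) this
  have hyAC : ∀ i, AbsolutelyContinuousOnInterval (y i) a b := fun i ↦
    (AbsolutelyContinuousOnInterval.const (x₀ i) a b).add
      ((hcoord i).absolutelyContinuousOnInterval_intervalIntegral left_mem_uIcc)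
  have hV : AbsolutelyContinuousOnInterval (fun t ↦ ∑ i, y i t * y i t) a b :=
    .fun_sum _ fun i _ ↦ (hyAC i).fun_mul (hyAC i)
  have hVx : ∀ u ∈ Icc a b, ∑ i, y i u * y i u = ‖x u‖ ^ 2 := by
    intro u hu
    rw [EuclideanSpace.real_norm_sq_eq]
    exact Finset.sum_congr rfl fun i _ ↦ by rw [hxy u hu i, sq]
  have hderiv : ∀ᵐ t, t ∈ uIcc a b → deriv (fun t ↦ ∑ i, y i t * y i t) t ≤
      α t * (∑ i, y i t * y i t) + β t := by
    filter_upwards [hf.ae_forall_inner_le h,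
      ae_all_iff.2 fun i ↦ (hcoord i).ae_hasDerivAt_integral] with t h₁ h₂ ht
    have ht' : t ∈ Icc a b := by rwa [uIcc_of_le hab] at ht
    have hdy : ∀ i, HasDerivAt (y i) (f t (x t) i) t := fun i ↦
      (h₂ i ht a left_mem_uIcc).const_add (x₀ i)
    rw [(HasDerivAt.fun_sum fun i _ ↦ (hdy i).fun_mul (hdy i)).deriv, hVx t ht']
    refine le_trans (le_of_eq ?_) (h₁ (x t))
    rw [PiLp.inner_apply, Finset.mul_sum]
    refine Finset.sum_congr rfl fun i _ ↦ ?_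
    rw [hxy t ht' i]
    simp only [RCLike.inner_apply, conj_trivial]
    ring
  have key := hV.le_exp_integral_mul_add hab (hα.intervalIntegrable a b)
    (hβ.intervalIntegrable a b) hderiv
  have hxa : x a = x₀ := by simpa using hsol a (left_mem_Icc.2 hab)
  simpa only [hVx a (left_mem_Icc.2 hab), hVx b (right_mem_Icc.2 hab), hxa] using key

/-- A nonnegative function whose integrals over unit intervals are bounded by `c` has exponentially
weighted integrals bounded by `c / (1 - exp (-ρ))`. -/
theorem LocInt.integral_exp_neg_mul_le {β : ℝ → ℝ} (hβ : LocInt β) (hβ0 : ∀ t, 0 ≤ β t) {c ρ : ℝ}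
    (hρ : 0 < ρ) (hc : ∀ t : ℝ, ∫ u in t..(t + 1), β u ≤ c) {a b : ℝ} (hab : a ≤ b) :
    ∫ s in a..b, Real.exp (-ρ * (b - s)) * β s ≤ c / (1 - Real.exp (-ρ)) := by
  have hq : Real.exp (-ρ) < 1 := Real.exp_lt_one_iff.2 (by linarith)
  have hc0 : 0 ≤ c :=
    (intervalIntegral.integral_nonneg (by norm_num) fun u _ ↦ hβ0 u).trans (hc 0)
  have hcC : c ≤ c / (1 - Real.exp (-ρ)) :=
    le_div_self hc0 (by linarith) (by linarith [Real.exp_pos (-ρ)])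
  have hfix : Real.exp (-ρ) * (c / (1 - Real.exp (-ρ))) + c = c / (1 - Real.exp (-ρ)) := by
    have : 1 - Real.exp (-ρ) ≠ 0 := by linarith
    field_simp
    ring
  have hwint : ∀ d u v : ℝ,
      IntervalIntegrable (fun s ↦ Real.exp (-ρ * (d - s)) * β s) volume u v :=
    fun d u v ↦ (hβ.intervalIntegrable u v).continuousOn_mul (by fun_prop)
  have hshort : ∀ u v : ℝ, u ≤ v → v ≤ u + 1 →
      ∫ s in u..v, Real.exp (-ρ * (v - s)) * β s ≤ c := by
    intro u v huv hvu
    calc ∫ s in u..v, Real.exp (-ρ * (v - s)) * β s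
        ≤ ∫ s in u..v, β s := by
          refine intervalIntegral.integral_mono_on huv (hwint v u v)
            (hβ.intervalIntegrable u v) fun s hs ↦ mul_le_of_le_one_left (hβ0 s) ?_
          exact Real.exp_le_one_iff.2 (by nlinarith [hs.2])
      _ ≤ ∫ s in u..(u + 1), β s :=
          intervalIntegral.integral_mono_interval le_rfl huv hvu
            (Eventually.of_forall hβ0) (hβ.intervalIntegrable _ _)
      _ ≤ c := hc u
  have main : ∀ n : ℕ, ∀ b, a ≤ b → b ≤ a + n →
      ∫ s in a..b, Real.exp (-ρ * (b - s)) * β s ≤ c / (1 - Real.exp (-ρ)) := by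
    intro n
    induction n with
    | zero =>
      intro b h₁ h₂
      exact (hshort a b h₁ (by push_cast at h₂; linarith)).trans hcC
    | succ n ih =>
      intro b h₁ h₂
      push_cast at h₂
      rcases le_total b (a + 1) with hb | hb
      · exact (hshort a b h₁ hb).trans hcC
      rw [← intervalIntegral.integral_add_adjacent_intervals (hwint b a (b - 1))
        (hwint b (b - 1) b), ← hfix]
      refine add_le_add ?_ (hshort (b - 1) b (by linarith) (by linarith))
      have hshift : ∫ s in a..(b - 1), Real.exp (-ρ * (b - s)) * β s =
          Real.exp (-ρ) * ∫ s in a..(b - 1), Real.exp (-ρ * (b - 1 - s)) * β s := by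
        rw [← intervalIntegral.integral_const_mul]
        refine intervalIntegral.integral_congr fun s _ ↦ ?_
        rw [← mul_assoc, ← Real.exp_add]
        ring_nf
      rw [hshift]
      exact mul_le_mul_of_nonneg_left (ih (b - 1) (by linarith) (by linarith)) (Real.exp_pos _).le
  obtain ⟨n, hn⟩ := exists_nat_ge (b - a)
  exact main n b hab (by linarith)

/-- Exponential decay on `[0, ∞)` extends to `[τ, ∞)` at the cost of a constant depending
monotonically on `τ`. -/
theorem LocInt.exists_antitone_exp_integral_le {α : ℝ → ℝ} (hα : LocInt α) {K ρ : ℝ} (hK : 1 ≤ K)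
    (hρ : 0 < ρ) (h : ∀ s t : ℝ, 0 ≤ s → s ≤ t →
      Real.exp (∫ u in s..t, α u) ≤ K * Real.exp (-ρ * (t - s))) :
    ∃ κ : ℝ → ℝ, Antitone κ ∧ (∀ τ, 0 < κ τ) ∧ ∀ τ s t : ℝ, τ ≤ s → s ≤ t →
      Real.exp (∫ u in s..t, α u) ≤ κ τ * Real.exp (-ρ * (t - s)) := by
  have hg : ∀ a b, IntervalIntegrable (fun u ↦ |α u| + ρ) volume a b := fun a b ↦
    (hα.intervalIntegrable a b).abs.add intervalIntegrable_const
  have hg0 : ∀ u, 0 ≤ |α u| + ρ := fun u ↦ by positivity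
  have hmono : ∀ a b c d : ℝ, c ≤ a → a ≤ b → b ≤ d →
      ∫ u in a..b, (|α u| + ρ) ≤ ∫ u in c..d, (|α u| + ρ) := fun a b c d h₁ h₂ h₃ ↦
    intervalIntegral.integral_mono_interval h₁ h₂ h₃ (Eventually.of_forall hg0) (hg c d)
  have hαg : ∀ s t : ℝ, s ≤ t → ∫ u in s..t, α u ≤ (∫ u in s..t, (|α u| + ρ)) - ρ * (t - s) := by
    intro s t hst
    rw [intervalIntegral.integral_add (hα.intervalIntegrable s t).abs intervalIntegrable_const,
      intervalIntegral.integral_const, smul_eq_mul]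
    have : ∫ u in s..t, α u ≤ ∫ u in s..t, |α u| :=
      intervalIntegral.integral_mono_on hst (hα.intervalIntegrable s t)
        (hα.intervalIntegrable s t).abs fun u _ ↦ le_abs_self _
    linarith
  have hK0 : 0 < K := by linarith
  refine ⟨fun τ ↦ K * Real.exp (∫ u in (min τ 0)..0, (|α u| + ρ)), fun τ σ hτσ ↦ ?_,
    fun τ ↦ by positivity, fun τ s t hτs hst ↦ ?_⟩
  · refine mul_le_mul_of_nonneg_left (Real.exp_le_exp.2 ?_) hK0.le
    exact hmono _ _ _ _ (min_le_min_right 0 hτσ) (min_le_right _ _) le_rfl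
  dsimp only
  rcases le_total 0 s with hs | hs
  · refine (h s t hs hst).trans (mul_le_mul_of_nonneg_right ?_ (Real.exp_pos _).le)
    exact le_mul_of_one_le_right hK0.le (Real.one_le_exp
      (intervalIntegral.integral_nonneg (min_le_right _ _) fun u _ ↦ hg0 u))
  have hmin : min τ 0 ≤ s := (min_le_left _ _).trans hτs
  rcases le_total t 0 with ht | ht
  · calc Real.exp (∫ u in s..t, α u)
        ≤ Real.exp ((∫ u in (min τ 0)..0, (|α u| + ρ)) + -ρ * (t - s)) :=
          Real.exp_le_exp.2 (by linarith [hαg s t hst, hmono s t _ _ hmin hst ht])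
      _ ≤ _ := by
          rw [Real.exp_add]
          exact mul_le_mul_of_nonneg_right (le_mul_of_one_le_left (Real.exp_pos _).le hK)
            (Real.exp_pos _).le
  · rw [← intervalIntegral.integral_add_adjacent_intervals (hα.intervalIntegrable s 0)
      (hα.intervalIntegrable 0 t), Real.exp_add]
    calc Real.exp (∫ u in s..0, α u) * Real.exp (∫ u in (0 : ℝ)..t, α u)
        ≤ Real.exp ((∫ u in (min τ 0)..0, (|α u| + ρ)) + ρ * s) *
            (K * Real.exp (-ρ * (t - 0))) := by
          refine mul_le_mul (Real.exp_le_exp.2 ?_) (h 0 t le_rfl ht) (Real.exp_pos _).le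
            (Real.exp_pos _).le
          linarith [hαg s 0 hs, hmono s 0 _ _ hmin hs le_rfl]
      _ = _ := by
          rw [Real.exp_add, show -ρ * (t - s) = ρ * s + -ρ * (t - 0) by ring, Real.exp_add]
          ring

/-- under (H1), (H2*) and (H3), for each `τ` the solutions of
`ẋ = f(t,x)` are uniformly ultimately bounded on `[τ,∞)`, with bound `c(τ)` and
waiting time `T(τ,d)` nonincreasing in `τ`. -/
theorem stmt17 {N : ℕ} (f : ℝ → Euc N → Euc N) (hf : IsLC f)
    (α β : ℝ → ℝ) (hα : LocInt α) (hβ : LocInt β) (hβ0 : ∀ t, 0 ≤ β t)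
    (hH1 : ∀ᵐ p : ℝ × Euc N, 2 * ⟪f p.1 p.2, p.2⟫ ≤ α p.1 * ‖p.2‖ ^ 2 + β p.1)
    (K α₁ : ℝ) (hK : 1 ≤ K) (hα₁ : 0 < α₁)
    (hH2s : ∀ s t : ℝ, 0 ≤ s → s ≤ t →
      Real.exp (∫ u in s..t, α u) ≤ K * Real.exp (-α₁ * (t - s)))
    (c₁ : ℝ) (hH3 : ∀ t : ℝ, ∫ u in t..(t + 1), β u ≤ c₁) :
    ∃ c : ℝ → ℝ, ∃ T : ℝ → ℝ → ℝ,
      Antitone c ∧ (∀ d, Antitone fun τ => T τ d) ∧ (∀ τ, 0 < c τ) ∧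
      (∀ τ : ℝ, ∀ d > (0:ℝ), 0 < T τ d) ∧
      ∀ τ : ℝ, ∀ r ≥ τ, ∀ d > (0:ℝ), ∀ t : ℝ, T τ d ≤ t →
        ∀ x₀ : Euc N, ‖x₀‖ ≤ d → ∀ x : ℝ → Euc N,
          ContinuousOn x (Icc r (t + r)) →
          (∀ u ∈ Icc r (t + r), x u = x₀ + ∫ v in r..u, f v (x v)) →
          ‖x (t + r)‖ ≤ c τ := by
  obtain ⟨κ, hκ, hκ0, hκexp⟩ := hα.exists_antitone_exp_integral_le hK hα₁ hH2s
  have hq : Real.exp (-α₁) < 1 := Real.exp_lt_one_iff.2 (by linarith)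
  have hc0 : 0 ≤ c₁ :=
    (intervalIntegral.integral_nonneg (by norm_num) fun u _ ↦ hβ0 u).trans (hH3 0)
  have hC0 : 0 ≤ c₁ / (1 - Real.exp (-α₁)) := div_nonneg hc0 (by linarith)
  refine ⟨fun τ ↦ 1 + κ τ * (c₁ / (1 - Real.exp (-α₁))), fun τ d ↦ κ τ * d ^ 2 / α₁ + 1,
    fun τ σ h ↦ ?_, fun d τ σ h ↦ ?_, fun τ ↦ ?_, fun τ d _ ↦ ?_, ?_⟩
  · exact add_le_add le_rfl (mul_le_mul_of_nonneg_right (hκ h) hC0)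
  · have := hκ h
    dsimp only
    gcongr
  · have := mul_nonneg (hκ0 τ).le hC0
    positivity
  · have := hκ0 τ
    positivity
  intro τ r hr d hd t ht x₀ hx₀ x hx hsol
  have hκτ := hκ0 τ
  have ht0 : 0 ≤ t := le_trans (by positivity) ht
  have hrt : r ≤ t + r := by linarith
  have hbound := hf.norm_sq_le hα hβ hH1 hrt hx hsol
  have hforcing : ∫ s in r..(t + r), Real.exp (∫ u in s..(t + r), α u) * β s ≤
      κ τ * (c₁ / (1 - Real.exp (-α₁))) := by
    refine le_trans ?_ (mul_le_mul_of_nonneg_left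
      (hβ.integral_exp_neg_mul_le hβ0 hα₁ hH3 hrt) hκτ.le)
    rw [← intervalIntegral.integral_const_mul]
    have hE : ContinuousOn (fun s ↦ Real.exp (∫ u in s..(t + r), α u)) (uIcc r (t + r)) := by
      simp_rw [intervalIntegral.integral_symm (t + r)]
      exact ((hα.intervalIntegrable r (t + r)).absolutelyContinuousOnInterval_intervalIntegral
        right_mem_uIcc).neg.exp.continuousOn
    refine intervalIntegral.integral_mono_on hrt
      ((hβ.intervalIntegrable _ _).continuousOn_mul hE)
      (((hβ.intervalIntegrable _ _).continuousOn_mul (by fun_prop)).const_mul _) fun s hs ↦ ?_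
    rw [← mul_assoc]
    exact mul_le_mul_of_nonneg_right (hκexp τ s (t + r) (hr.trans hs.1) hs.2) (hβ0 s)
  have hinitial : Real.exp (∫ u in r..(t + r), α u) * ‖x₀‖ ^ 2 ≤ 1 := by
    have h₁ := hκexp τ r (t + r) hr hrt
    rw [add_sub_cancel_right] at h₁
    have h₂ : κ τ * d ^ 2 ≤ Real.exp (α₁ * t) := by
      have h₃ := mul_le_mul_of_nonneg_left ht hα₁.le
      rw [mul_add, mul_div_cancel₀ _ hα₁.ne'] at h₃
      linarith [Real.add_one_le_exp (α₁ * t)]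
    calc Real.exp (∫ u in r..(t + r), α u) * ‖x₀‖ ^ 2
        ≤ κ τ * Real.exp (-α₁ * t) * d ^ 2 := by gcongr
      _ = κ τ * d ^ 2 * Real.exp (-α₁ * t) := by ring
      _ ≤ Real.exp (α₁ * t) * Real.exp (-α₁ * t) := by gcongr
      _ = 1 := by rw [← Real.exp_add]; simp
  have hnn := mul_nonneg hκτ.le hC0
  dsimp only
  nlinarith [norm_nonneg (x (t + r))]
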